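/- Even central moments of branch numbers of general order: for every fixed r ≥ 1 and s ≥ 0, the expectation ⟨(S_{r+1,n} − n/4^r)^{2s}⟩ under P_n is asymptotically equivalent, as n → ∞, to ((2s−1)!!/4^{2sr})·((4^r − 1)/3)^s·n^s. -/

import Mathlib

open MeasureTheory ProbabilityTheory Filter
open scoped NNReal Topology

/-- Binary trees: every internal node has exactly two children. -/
inductive BinTree : Type
  | leaf : BinTree
  | node : BinTree → BinTree → BinTree
  deriving DecidableEq

namespace BinTree

/-- The magnitude of a binary tree is its number of leaves. -/
def magnitude : BinTree → ℕ
  | leaf => 1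
  | node l r => magnitude l + magnitude r

/-- The Horton–Strahler order of (the root of) a binary tree:
leaves have order 1; a node whose two children have distinct orders has the max of the two;
a node whose two children have equal order `r` has order `r + 1`. -/
def ord : BinTree → ℕ
  | leaf => 1
  | node l r => if ord l = ord r then ord l + 1 else max (ord l) (ord r)

/-- `branches k τ` is `S_{k,n}(τ)`, the number of Horton–Strahler branches of order `k`
in `τ`, i.e. the number of maximal connected paths of nodes of order `k`.  It counts the
nodes of order `k` that head a branch: a new branch head of order `ord l + 1` is created
exactly at a node whose two children have equal order `ord l`, and every leaf heads an
order-1 branch. -/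
def branches (k : ℕ) : BinTree → ℕ
  | leaf => if k = 1 then 1 else 0
  | node l r => branches k l + branches k r +
      (if ord l = ord r ∧ ord l + 1 = k then 1 else 0)

end BinTree

/-- `treesOf n` is the finite set `Ω_n` of binary trees of magnitude `n`. -/
def treesOf : ℕ → Finset BinTree
  | 0 => ∅
  | 1 => {BinTree.leaf}
  | (n+2) => (Finset.range (n+1)).attach.biUnion fun k =>
      ((treesOf (k.1+1)) ×ˢ (treesOf (n+1-k.1))).image fun p => BinTree.node p.1 p.2
  decreasing_by
  · have := Finset.mem_range.mp k.2; omega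
  · omega

/-- Expectation `⟨f⟩` under the uniform probability measure `P_n` on `Ω_n` (the random model). -/
noncomputable def expect (n : ℕ) (f : BinTree → ℝ) : ℝ :=
  (∑ τ ∈ treesOf n, f τ) / (treesOf n).card




namespace BinTree

open Finset

lemma one_le_magnitude (τ : BinTree) : 1 ≤ τ.magnitude := by
  induction τ with
  | leaf => simp [magnitude]
  | node l r hl hr => simp only [magnitude]; omega

lemma mem_treesOf (τ : BinTree) (n : ℕ) : τ ∈ treesOf n ↔ τ.magnitude = n := by
  induction τ generalizing n with
  | leaf =>
    match n with
    | 0 => simp [treesOf, magnitude]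
    | 1 => simp [treesOf, magnitude]
    | n + 2 => simp [treesOf, magnitude]
  | node l r hl hr =>
    have h1 := one_le_magnitude l
    have h2 := one_le_magnitude r
    match n with
    | 0 => simp only [treesOf, magnitude, notMem_empty, false_iff]; omega
    | 1 => simp only [treesOf, magnitude, mem_singleton, reduceCtorEq, false_iff]; omega
    | n + 2 =>
      rw [treesOf]
      simp only [mem_biUnion, mem_attach, mem_image, mem_product, true_and, Subtype.exists,
        mem_range, Prod.exists, node.injEq, magnitude]
      constructor
      · rintro ⟨k, hk, a, b, ⟨ha, hb⟩, rfl, rfl⟩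
        rw [hl] at ha; rw [hr] at hb
        omega
      · intro h
        refine ⟨l.magnitude - 1, by omega, l, r, ⟨?_, ?_⟩, rfl, rfl⟩
        · rw [hl]; omega
        · rw [hr]; omega

/-- The generating function of a weight on binary trees, by magnitude. -/
noncomputable def genFun (φ : BinTree → ℝ) : PowerSeries ℝ :=
  PowerSeries.mk fun n => ∑ τ ∈ treesOf n, φ τ

/-- The generating function of a weight on pairs of binary trees, by total magnitude. -/
noncomputable def genFun₂ (ψ : BinTree → BinTree → ℝ) : PowerSeries ℝ :=
  PowerSeries.mk fun n =>
    ∑ p ∈ antidiagonal n, ∑ l ∈ treesOf p.1, ∑ r ∈ treesOf p.2, ψ l r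

lemma genFun₂_mul (a b : BinTree → ℝ) :
    genFun₂ (fun l r => a l * b r) = genFun a * genFun b := by
  ext n
  simp [genFun₂, genFun, PowerSeries.coeff_mul, sum_mul_sum]

lemma genFun₂_add (a b : BinTree → BinTree → ℝ) :
    genFun₂ (fun l r => a l r + b l r) = genFun₂ a + genFun₂ b := by
  ext n
  simp [genFun₂, sum_add_distrib]

lemma sum_treesOf_node (φ : BinTree → ℝ) (n : ℕ) :
    ∑ τ ∈ treesOf (n + 2), φ τ =
      ∑ p ∈ antidiagonal (n + 2), ∑ l ∈ treesOf p.1, ∑ r ∈ treesOf p.2, φ (node l r) := by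
  have h : treesOf (n + 2) = (antidiagonal (n + 2)).biUnion fun p =>
      (treesOf p.1 ×ˢ treesOf p.2).image fun q => node q.1 q.2 := by
    ext τ
    cases τ with
    | leaf => simp [mem_treesOf, magnitude]
    | node l r => simp [mem_treesOf, magnitude]
  rw [h, sum_biUnion]
  · refine sum_congr rfl fun p _ => ?_
    rw [sum_image, sum_product]
    rintro ⟨a, b⟩ _ ⟨c, d⟩ _ h
    simpa using h
  · intro p _ q _ hpq
    rw [Function.onFun, disjoint_left]
    simp only [mem_image, mem_product, mem_treesOf]
    rintro _ ⟨a, ⟨h1, h2⟩, rfl⟩ ⟨b, ⟨h3, h4⟩, h5⟩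
    simp only [node.injEq] at h5
    apply hpq
    ext
    · rw [← h1, ← h3, h5.1]
    · rw [← h2, ← h4, h5.2]

lemma genFun_eq (φ : BinTree → ℝ) :
    genFun φ = PowerSeries.C (φ leaf) * PowerSeries.X + genFun₂ fun l r => φ (node l r) := by
  ext n
  match n with
  | 0 => simp [genFun, genFun₂, treesOf]
  | 1 => simp [genFun, genFun₂, treesOf, Finset.Nat.antidiagonal_succ]
  | n + 2 => simp [genFun, genFun₂, sum_treesOf_node]

/-- Removal of all leaves of a binary tree, followed by the suppression of the nodes left with a
single child. -/
def prune : BinTree → Option BinTree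
  | leaf => none
  | node l r =>
    match prune l, prune r with
    | none, none => some leaf
    | some a, none => some a
    | none, some b => some b
    | some a, some b => some (node a b)

lemma prune_eq_none_iff (τ : BinTree) : prune τ = none ↔ τ = leaf := by
  cases τ with
  | leaf => simp [prune]
  | node l r => simp only [prune]; split <;> simp

lemma magnitude_of_prune {τ σ : BinTree} (h : prune τ = some σ) : σ.magnitude ≤ τ.magnitude := by
  induction τ generalizing σ with
  | leaf => simp [prune] at h
  | node l r hl hr =>
    have h1 := one_le_magnitude l
    simp only [prune] at h
    split at h <;> simp only [Option.some.injEq] at h <;> subst h <;> simp only [magnitude]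
    · omega
    · have := hl ‹_›; omega
    · have := hr ‹_›; omega
    · have := hl ‹_›; have := hr ‹_›; omega

lemma one_le_ord (τ : BinTree) : 1 ≤ τ.ord := by
  induction τ with
  | leaf => simp [ord]
  | node l r hl hr => simp only [ord]; split <;> omega

lemma ord_of_prune {τ σ : BinTree} (h : prune τ = some σ) : τ.ord = σ.ord + 1 := by
  induction τ generalizing σ with
  | leaf => simp [prune] at h
  | node l r hl hr =>
    simp only [prune] at h
    split at h <;> simp only [Option.some.injEq] at h <;> subst h
    · simp_all [prune_eq_none_iff, ord]
    · rename_i a e1 e2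
      have := one_le_ord a
      rw [prune_eq_none_iff] at e2
      subst e2
      simp only [ord, hl e1]
      split <;> omega
    · rename_i a e1 e2
      have := one_le_ord a
      rw [prune_eq_none_iff] at e1
      subst e1
      simp only [ord, hr e2]
      split <;> omega
    · rename_i a b e1 e2
      simp only [ord, hl e1, hr e2]
      split <;> split <;> omega

lemma branches_add_two_of_prune (k : ℕ) {τ σ : BinTree} (h : prune τ = some σ) :
    branches (k + 2) τ = branches (k + 1) σ := by
  induction τ generalizing σ with
  | leaf => simp [prune] at h
  | node l r hl hr =>
    simp only [prune] at h
    split at h <;> simp only [Option.some.injEq] at h <;> subst h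
    · simp_all [prune_eq_none_iff, branches, ord, eq_comm]
    · rename_i a e1 e2
      have := one_le_ord a
      rw [prune_eq_none_iff] at e2
      subst e2
      simp [branches, hl e1, ord, ord_of_prune e1]
      omega
    · rename_i a e1 e2
      have := one_le_ord a
      rw [prune_eq_none_iff] at e1
      subst e1
      simp [branches, hr e2, ord, ord_of_prune e2]
      omega
    · rename_i a b e1 e2
      simp [branches, hl e1, hr e2, ord_of_prune e1, ord_of_prune e2]

lemma branches_one (τ : BinTree) : branches 1 τ = τ.magnitude := by
  induction τ with
  | leaf => simp [branches, magnitude]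
  | node l r hl hr =>
    have := one_le_ord l
    simp [branches, magnitude, hl, hr]
    omega

/-- The indicator of the trees with a given pruning. -/
noncomputable def pruneInd (o : Option BinTree) (τ : BinTree) : ℝ := if prune τ = o then 1 else 0

/-- The power series `1 / (1 - 2 X)`. -/
noncomputable def geomTwo : PowerSeries ℝ := PowerSeries.mk fun n => 2 ^ n

lemma geomTwo_eq_rescale : geomTwo = PowerSeries.rescale 2 (PowerSeries.mk 1) := by
  ext n; simp [geomTwo]

lemma one_sub_mul_geomTwo : (1 - 2 * PowerSeries.X) * geomTwo = 1 := by
  have h := congrArg (PowerSeries.rescale (2 : ℝ)) (PowerSeries.mk_one_mul_one_sub_eq_one ℝ)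
  rw [map_mul, map_sub, map_one, ← geomTwo_eq_rescale, PowerSeries.rescale_X, map_ofNat] at h
  rw [mul_comm, h]

lemma coeff_geomTwo_pow (d k : ℕ) :
    PowerSeries.coeff k (geomTwo ^ (d + 1)) = (Nat.choose (d + k) d : ℝ) * 2 ^ k := by
  rw [geomTwo_eq_rescale, ← map_pow, PowerSeries.mk_one_pow_eq_mk_choose_add]
  simp [mul_comm]

lemma genFun_pruneInd_none : genFun (pruneInd none) = PowerSeries.X := by
  rw [genFun_eq]
  have : (fun l r => pruneInd none (node l r)) = fun _ _ => 0 := by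
    funext l r
    simp [pruneInd, prune_eq_none_iff]
  rw [this]
  ext n
  simp [genFun₂, pruneInd, prune]

lemma pruneInd_leaf_node (l r : BinTree) : pruneInd (some leaf) (node l r) =
    pruneInd none l * pruneInd none r + (pruneInd (some leaf) l * pruneInd none r +
      pruneInd none l * pruneInd (some leaf) r) := by
  cases hl : prune l <;> cases hr : prune r <;> simp [pruneInd, prune, hl, hr]

lemma pruneInd_node_node (a b l r : BinTree) : pruneInd (some (node a b)) (node l r) =
    pruneInd (some a) l * pruneInd (some b) r + (pruneInd (some (node a b)) l * pruneInd none r +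
      pruneInd none l * pruneInd (some (node a b)) r) := by
  cases hl : prune l <;> cases hr : prune r <;> simp [pruneInd, prune, hl, hr, ite_and]
  split_ifs <;> rfl

lemma eq_mul_geomTwo {A B : PowerSeries ℝ}
    (h : A = B + (A * PowerSeries.X + PowerSeries.X * A)) : A = B * geomTwo := by
  have h' : A * (1 - 2 * PowerSeries.X) = B := by linear_combination h
  rw [← h', mul_assoc, one_sub_mul_geomTwo, mul_one]

lemma genFun_pruneInd_some (σ : BinTree) : genFun (pruneInd (some σ)) =
    PowerSeries.X ^ (2 * σ.magnitude) * geomTwo ^ (2 * σ.magnitude - 2 + 1) := by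
  induction σ with
  | leaf =>
    have h := genFun_eq (pruneInd (some leaf))
    simp only [pruneInd_leaf_node, genFun₂_add, genFun₂_mul, genFun_pruneInd_none] at h
    have h0 : pruneInd (some leaf) leaf = 0 := by simp [pruneInd, prune]
    rw [h0, map_zero, zero_mul, zero_add] at h
    rw [eq_mul_geomTwo h]
    simp only [magnitude]
    ring
  | node a b ha hb =>
    have h := genFun_eq (pruneInd (some (node a b)))
    simp only [pruneInd_node_node, genFun₂_add, genFun₂_mul, genFun_pruneInd_none] at h
    have h0 : pruneInd (some (node a b)) leaf = 0 := by simp [pruneInd, prune]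
    rw [h0, map_zero, zero_mul, zero_add] at h
    rw [eq_mul_geomTwo h, ha, hb]
    simp only [magnitude]
    obtain ⟨p, hp⟩ := Nat.exists_eq_add_of_le (one_le_magnitude a)
    obtain ⟨q, hq⟩ := Nat.exists_eq_add_of_le (one_le_magnitude b)
    rw [hp, hq, show 2 * (1 + p) - 2 = 2 * p by omega, show 2 * (1 + q) - 2 = 2 * q by omega,
      show 2 * (1 + p + (1 + q)) - 2 = 2 * p + 2 * q + 2 by omega]
    ring

/-- The number of trees of magnitude `n` whose pruning is a given tree of magnitude `m`. -/
noncomputable def pruneCount (n m : ℕ) : ℝ :=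
  if 2 * m ≤ n then (Nat.choose (n - 2) (2 * m - 2) : ℝ) * 2 ^ (n - 2 * m) else 0

lemma sum_pruneInd (n : ℕ) (σ : BinTree) :
    ∑ τ ∈ treesOf n, pruneInd (some σ) τ = pruneCount n σ.magnitude := by
  have h : PowerSeries.coeff n (genFun (pruneInd (some σ))) =
      ∑ τ ∈ treesOf n, pruneInd (some σ) τ := by simp [genFun]
  have h1 := one_le_magnitude σ
  rw [← h, genFun_pruneInd_some, PowerSeries.coeff_X_pow_mul', pruneCount]
  split
  · rw [coeff_geomTwo_pow, show 2 * σ.magnitude - 2 + (n - 2 * σ.magnitude) = n - 2 by omega]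
  · rfl

lemma card_treesOf_succ (n : ℕ) : (treesOf (n + 1)).card = catalan n := by
  induction n using Nat.strong_induction_on with
  | _ n ih =>
    match n with
    | 0 => simp [treesOf]
    | n + 1 =>
      have h := sum_treesOf_node (fun _ => 1) n
      simp only [sum_const, nsmul_eq_mul, mul_one] at h
      have h' : (treesOf (n + 1 + 1)).card =
          ∑ p ∈ antidiagonal (n + 2), (treesOf p.1).card * (treesOf p.2).card := by
        exact_mod_cast h
      rw [h', catalan_succ', Nat.sum_antidiagonal_succ, Nat.sum_antidiagonal_succ']
      simp only [treesOf, card_empty, zero_mul, mul_zero, zero_add]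
      refine sum_congr rfl fun p hp => ?_
      rw [HasAntidiagonal.mem_antidiagonal] at hp
      rw [ih _ (by omega), ih _ (by omega)]

lemma card_treesOf_recurrence (m : ℕ) (hm : 1 ≤ m) :
    ((m : ℝ) + 1) * (treesOf (m + 1)).card = 2 * (2 * m - 1) * (treesOf m).card := by
  obtain ⟨k, rfl⟩ := Nat.exists_eq_add_of_le' hm
  rw [card_treesOf_succ, card_treesOf_succ]
  have h1 := succ_mul_catalan_eq_centralBinom k
  have h2 := succ_mul_catalan_eq_centralBinom (k + 1)
  have h3 := Nat.succ_mul_centralBinom_succ k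
  rw [← h1, ← h2] at h3
  have h4 : (k + 1) * ((k + 1 + 1) * catalan (k + 1)) =
      (k + 1) * (2 * (2 * k + 1) * catalan k) := by rw [h3]; ring
  have h5 := Nat.eq_of_mul_eq_mul_left (Nat.succ_pos k) h4
  have h6 : ((k : ℝ) + 1 + 1) * catalan (k + 1) = 2 * (2 * k + 1) * catalan k := by
    exact_mod_cast h5
  push_cast
  linear_combination h6

lemma pruneCount_recurrence (n m : ℕ) (hm : 1 ≤ m) :
    8 * m * (2 * m - 1) * pruneCount n (m + 1) =
      ((n : ℝ) - 2 * m) * (n - 2 * m - 1) * pruneCount n m := by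
  unfold pruneCount
  by_cases h : 2 * (m + 1) ≤ n
  · obtain ⟨k, rfl⟩ := Nat.exists_eq_add_of_le h
    obtain ⟨j, rfl⟩ := Nat.exists_eq_add_of_le' hm
    rw [if_pos h, if_pos (by omega), show 2 * (j + 1 + 1) + k - 2 = 2 * j + 2 + k by omega,
      show 2 * (j + 1 + 1) - 2 = 2 * j + 2 by omega, show 2 * (j + 1) - 2 = 2 * j by omega,
      show 2 * (j + 1 + 1) + k - 2 * (j + 1 + 1) = k by omega,
      show 2 * (j + 1 + 1) + k - 2 * (j + 1) = k + 2 by omega]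
    have h1 := Nat.choose_succ_right_eq (2 * j + 2 + k) (2 * j + 1)
    have h2 := Nat.choose_succ_right_eq (2 * j + 2 + k) (2 * j)
    rw [show 2 * j + 2 + k - (2 * j + 1) = k + 1 by omega] at h1
    rw [show 2 * j + 2 + k - (2 * j) = k + 2 by omega] at h2
    have h1' : (Nat.choose (2 * j + 2 + k) (2 * j + 2) : ℝ) * (2 * j + 2) =
      Nat.choose (2 * j + 2 + k) (2 * j + 1) * (k + 1) := by exact_mod_cast h1
    have h2' : (Nat.choose (2 * j + 2 + k) (2 * j + 1) : ℝ) * (2 * j + 1) =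
      Nat.choose (2 * j + 2 + k) (2 * j) * (k + 2) := by exact_mod_cast h2
    push_cast
    rw [pow_add]
    linear_combination (4 * (2 * (j : ℝ) + 1) * 2 ^ k) * h1' + (4 * ((k : ℝ) + 1) * 2 ^ k) * h2'
  · rw [if_neg h]
    by_cases h' : 2 * m ≤ n
    · have : n = 2 * m ∨ n = 2 * m + 1 := by omega
      rcases this with rfl | rfl <;> simp
    · simp [h']

/-- The distribution of the magnitude of the pruning of a uniform tree of magnitude `n`. -/
noncomputable def pruneLaw (n m : ℕ) : ℝ :=
  pruneCount n m * (treesOf m).card / (treesOf n).card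

lemma pruneLaw_nonneg (n m : ℕ) : 0 ≤ pruneLaw n m := by
  unfold pruneLaw pruneCount
  split <;> positivity

lemma pruneLaw_recurrence (n m : ℕ) :
    4 * (m + 1) * m * pruneLaw n (m + 1) = ((n : ℝ) - 2 * m) * (n - 2 * m - 1) * pruneLaw n m := by
  rcases Nat.eq_zero_or_pos m with rfl | hm
  · simp [pruneLaw, treesOf]
  · have h1 := pruneCount_recurrence n m hm
    have h2 := card_treesOf_recurrence m hm
    unfold pruneLaw
    rw [← mul_div_assoc, ← mul_div_assoc]
    congr 1
    linear_combination (4 * (m : ℝ) * pruneCount n (m + 1)) * h2 + ((treesOf m).card : ℝ) * h1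

lemma expect_prune (n : ℕ) (f : BinTree → ℝ) :
    _root_.expect n (fun τ => (prune τ).elim 0 f) =
      ∑ m ∈ range (n + 1), pruneLaw n m * _root_.expect m f := by
  have h1 : ∀ m, pruneLaw n m * _root_.expect m f =
      (∑ σ ∈ treesOf m, pruneCount n m * f σ) / (treesOf n).card := by
    intro m
    rw [← mul_sum, _root_.expect, pruneLaw]
    rcases Nat.eq_zero_or_pos (treesOf m).card with h | h
    · rw [card_eq_zero] at h
      simp [h]
    · field_simp
  simp only [h1]
  rw [← sum_div, _root_.expect]
  congr 1
  have h2 : ∀ m, ∑ σ ∈ treesOf m, pruneCount n m * f σ =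
      ∑ τ ∈ treesOf n, ∑ σ ∈ treesOf m, pruneInd (some σ) τ * f σ := by
    intro m
    rw [sum_comm]
    refine sum_congr rfl fun σ hσ => ?_
    rw [← sum_mul, sum_pruneInd, (mem_treesOf _ _).1 hσ]
  simp only [h2]
  rw [sum_comm]
  refine sum_congr rfl fun τ hτ => ?_
  cases h : prune τ with
  | none => simp [pruneInd, h]
  | some σ =>
    have h3 := magnitude_of_prune h
    rw [(mem_treesOf _ _).1 hτ] at h3
    rw [sum_eq_single_of_mem σ.magnitude (by simpa using Nat.lt_succ_of_le h3),
      sum_eq_single_of_mem σ ((mem_treesOf _ _).2 rfl)]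
    · simp [pruneInd, h]
    · intro b _ hb
      simp [pruneInd, h, hb.symm]
    · intro m _ hm
      refine sum_eq_zero fun b hb => ?_
      rw [mem_treesOf] at hb
      have : σ ≠ b := by rintro rfl; exact hm hb.symm
      simp [pruneInd, h, this]

lemma expect_congr {n : ℕ} {f g : BinTree → ℝ} (h : ∀ τ ∈ treesOf n, f τ = g τ) :
    _root_.expect n f = _root_.expect n g := by
  simp only [_root_.expect, sum_congr rfl h]

lemma expect_branches_add_two (k : ℕ) {n : ℕ} (hn : 2 ≤ n) (g : ℕ → ℝ) :
    _root_.expect n (fun τ => g (branches (k + 2) τ)) =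
      ∑ m ∈ range (n + 1), pruneLaw n m * _root_.expect m fun σ => g (branches (k + 1) σ) := by
  rw [← expect_prune]
  refine expect_congr fun τ hτ => ?_
  cases h : prune τ with
  | none =>
    rw [prune_eq_none_iff] at h
    rw [h, mem_treesOf, magnitude] at hτ
    omega
  | some σ => simp [branches_add_two_of_prune k h]

lemma expect_const {n : ℕ} (hn : 1 ≤ n) (c : ℝ) : _root_.expect n (fun _ => c) = c := by
  obtain ⟨k, rfl⟩ := Nat.exists_eq_add_of_le' hn
  have h := succ_mul_catalan_eq_centralBinom k
  have h0 := Nat.centralBinom_pos k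
  have : 0 < catalan k := by
    rw [← h] at h0
    exact Nat.pos_of_mul_pos_left h0
  rw [_root_.expect, card_treesOf_succ, sum_const, card_treesOf_succ, nsmul_eq_mul]
  field_simp

lemma sum_pruneLaw {n : ℕ} (hn : 2 ≤ n) : ∑ m ∈ range (n + 1), pruneLaw n m = 1 := by
  have h := expect_branches_add_two 0 hn (fun _ => 1)
  rw [expect_const (by omega)] at h
  rw [h]
  refine sum_congr rfl fun m _ => ?_
  rcases Nat.eq_zero_or_pos m with rfl | hm
  · simp [pruneLaw, treesOf]
  · rw [expect_const hm, mul_one]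

lemma sum_pruneLaw_shift {n : ℕ} (hn : 1 ≤ n) (f : ℕ → ℝ) :
    ∑ m ∈ range (n + 1), pruneLaw n m * (4 * m * (m - 1) * f m) =
      ∑ m ∈ range (n + 1), pruneLaw n m * ((n - 2 * m) * (n - 2 * m - 1) * f (m + 1)) := by
  have h0 : pruneLaw n n = 0 := by
    simp [pruneLaw, pruneCount, show ¬ 2 * n ≤ n by omega]
  rw [sum_range_succ', sum_range_succ, h0]
  simp only [Nat.cast_zero, mul_zero, zero_mul, add_zero]
  refine sum_congr rfl fun m _ => ?_
  have h := pruneLaw_recurrence n m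
  push_cast
  linear_combination f (m + 1) * h

/-- The central moments of the magnitude of the pruning of a uniform tree of magnitude `n`. -/
noncomputable def pruneMoment (n j : ℕ) : ℝ :=
  ∑ m ∈ range (n + 1), pruneLaw n m * ((m : ℝ) - n / 4) ^ j

lemma pruneMoment_recurrence {n : ℕ} (hn : 1 ≤ n) (j : ℕ) :
    (4 * n - 6) * pruneMoment n (j + 1) = n / 2 * pruneMoment n j +
      ∑ i ∈ range j, (j.choose i : ℝ) * (((n : ℝ) ^ 2 / 4 - n / 2) * pruneMoment n i +
        (2 - 2 * n) * pruneMoment n (i + 1) + 4 * pruneMoment n (i + 2)) := by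
  have h := sum_pruneLaw_shift hn fun m => ((m : ℝ) - n / 4) ^ j
  have key : ∀ m : ℕ, pruneLaw n m *
      ((n - 2 * m) * (n - 2 * m - 1) * (((m + 1 : ℕ) : ℝ) - n / 4) ^ j) =
      pruneLaw n m * (4 * m * (m - 1) * ((m : ℝ) - n / 4) ^ j) +
      n / 2 * (pruneLaw n m * ((m : ℝ) - n / 4) ^ j) -
      (4 * n - 6) * (pruneLaw n m * ((m : ℝ) - n / 4) ^ (j + 1)) +
      ∑ i ∈ range j, (j.choose i : ℝ) *
        (((n : ℝ) ^ 2 / 4 - n / 2) * (pruneLaw n m * ((m : ℝ) - n / 4) ^ i) +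
        (2 - 2 * n) * (pruneLaw n m * ((m : ℝ) - n / 4) ^ (i + 1)) +
        4 * (pruneLaw n m * ((m : ℝ) - n / 4) ^ (i + 2))) := by
    intro m
    obtain ⟨y, hy⟩ : ∃ y : ℝ, y = (m : ℝ) - n / 4 := ⟨_, rfl⟩
    have hm : (m : ℝ) = y + n / 4 := by rw [hy]; ring
    have h1 : ∑ i ∈ range j, (j.choose i : ℝ) *
        (((n : ℝ) ^ 2 / 4 - n / 2) * (pruneLaw n m * y ^ i) +
        (2 - 2 * n) * (pruneLaw n m * y ^ (i + 1)) +
        4 * (pruneLaw n m * y ^ (i + 2))) =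
        pruneLaw n m * ((n - 2 * m) * (n - 2 * m - 1)) *
          ∑ i ∈ range j, y ^ i * 1 ^ (j - i) * (j.choose i : ℝ) := by
      rw [mul_sum]
      refine sum_congr rfl fun i _ => ?_
      rw [hm, one_pow]
      ring
    have h2 := add_pow y 1 j
    rw [sum_range_succ] at h2
    simp only [Nat.sub_self, pow_zero, Nat.choose_self, Nat.cast_one, mul_one] at h2
    rw [← hy, h1, show (((m + 1 : ℕ) : ℝ) - n / 4) = y + 1 by push_cast; rw [hm]; ring, h2, hm]
    ring
  simp only [key, sum_add_distrib, sum_sub_distrib, ← mul_sum] at h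
  rw [sum_comm] at h
  simp only [sum_add_distrib, ← mul_sum] at h
  simp only [pruneMoment]
  linear_combination h

/-- The moments of the centered normal distribution of variance `v`. -/
noncomputable def gaussMoment (v : ℝ) : ℕ → ℝ
  | 0 => 1
  | 1 => 0
  | j + 2 => (j + 1) * v * gaussMoment v j

lemma gaussMoment_scale (c v : ℝ) (j : ℕ) :
    gaussMoment (c ^ 2 * v) j = c ^ j * gaussMoment v j := by
  induction j using Nat.strong_induction_on with
  | _ j ih =>
    match j with
    | 0 => simp [gaussMoment]
    | 1 => simp [gaussMoment]
    | j + 2 =>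
      simp only [gaussMoment]
      rw [ih j (by omega)]
      ring

lemma gaussMoment_two_mul (v : ℝ) (s : ℕ) :
    gaussMoment v (2 * s) = (Nat.doubleFactorial (2 * s - 1) : ℝ) * v ^ s := by
  induction s with
  | zero => simp [gaussMoment]
  | succ s ih =>
    rw [show 2 * (s + 1) = 2 * s + 2 by ring, gaussMoment, ih]
    cases s with
    | zero => simp
    | succ t =>
      rw [show 2 * (t + 1) + 2 - 1 = (2 * (t + 1) - 1) + 2 by omega, Nat.doubleFactorial]
      have : ((2 * (t + 1) - 1 : ℕ) : ℝ) = 2 * (t + 1) - 1 := by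
        rw [Nat.cast_sub (by omega)]; push_cast; ring
      push_cast
      rw [this]
      ring

/-- The exponential generating function of the moments of a centered normal distribution. -/
noncomputable def gaussEGF (v : ℝ) : PowerSeries ℝ :=
  PowerSeries.mk fun j => gaussMoment v j / (j.factorial : ℝ)

lemma derivative_gaussEGF (v : ℝ) :
    PowerSeries.derivative ℝ (gaussEGF v) = PowerSeries.C v * PowerSeries.X * gaussEGF v := by
  ext j
  rw [PowerSeries.coeff_derivative, mul_assoc, PowerSeries.coeff_C_mul]
  cases j with
  | zero => simp [gaussEGF, gaussMoment]
  | succ j =>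
    rw [PowerSeries.coeff_succ_X_mul]
    simp only [gaussEGF, PowerSeries.coeff_mk, gaussMoment, Nat.factorial_succ]
    have := Nat.factorial_pos j
    push_cast
    field_simp

lemma gaussEGF_mul (a b : ℝ) : gaussEGF a * gaussEGF b = gaussEGF (a + b) := by
  have hd : PowerSeries.derivative ℝ (gaussEGF a * gaussEGF b) =
      PowerSeries.C (a + b) * PowerSeries.X * (gaussEGF a * gaussEGF b) := by
    rw [Derivation.leibniz, derivative_gaussEGF, derivative_gaussEGF, smul_eq_mul, smul_eq_mul,
      map_add]
    ring
  have hd' := derivative_gaussEGF (a + b)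
  ext j
  induction j using Nat.strong_induction_on with
  | _ j ih =>
    match j with
    | 0 => simp [gaussEGF, gaussMoment]
    | j + 1 =>
      have h1 := congrArg (PowerSeries.coeff j) hd
      have h2 := congrArg (PowerSeries.coeff j) hd'
      rw [PowerSeries.coeff_derivative, mul_assoc, PowerSeries.coeff_C_mul] at h1 h2
      have h3 : PowerSeries.coeff j (PowerSeries.X * (gaussEGF a * gaussEGF b)) =
          PowerSeries.coeff j (PowerSeries.X * gaussEGF (a + b)) := by
        cases j with
        | zero => simp
        | succ j =>
          rw [PowerSeries.coeff_succ_X_mul, PowerSeries.coeff_succ_X_mul, ih j (by omega)]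
      rw [h3, ← h2] at h1
      exact mul_right_cancel₀ (by positivity) h1

lemma sum_choose_gaussMoment (a b : ℝ) (j : ℕ) :
    ∑ i ∈ range (j + 1), (j.choose i : ℝ) * gaussMoment a i * gaussMoment b (j - i) =
      gaussMoment (a + b) j := by
  have h := congrArg (PowerSeries.coeff j) (gaussEGF_mul a b)
  simp only [PowerSeries.coeff_mul, gaussEGF, PowerSeries.coeff_mk] at h
  rw [Finset.Nat.sum_antidiagonal_eq_sum_range_succ_mk] at h
  have h0 : (j.factorial : ℝ) ≠ 0 := by positivity
  rw [eq_div_iff h0, sum_mul] at h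
  rw [← h]
  refine sum_congr rfl fun i hi => ?_
  have hi' : i ≤ j := Nat.lt_succ_iff.1 (mem_range.1 hi)
  have h1 : (i.factorial : ℝ) ≠ 0 := by positivity
  have h2 : ((j - i).factorial : ℝ) ≠ 0 := by positivity
  have h3 : (j.choose i : ℝ) * i.factorial * (j - i).factorial = j.factorial := by
    exact_mod_cast Nat.choose_mul_factorial_mul_factorial hi'
  rw [← h3]
  field_simp

/-- The central moments of the pruning law, in units of the square root of the magnitude. -/
noncomputable def pruneMomentNormalized (n j : ℕ) : ℝ := pruneMoment n j / √(n : ℝ) ^ j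

lemma pruneMomentNormalized_recurrence {n : ℕ} (hn : 1 ≤ n) (j : ℕ) :
    (4 - (10 + 4 * j) * (√(n : ℝ))⁻¹ ^ 2) * pruneMomentNormalized n (j + 2) =
      1 / 2 * (√(n : ℝ))⁻¹ * pruneMomentNormalized n (j + 1) +
      (j + 1) * ((1 / 4 - 1 / 2 * (√(n : ℝ))⁻¹ ^ 2) * pruneMomentNormalized n j +
        (2 * (√(n : ℝ))⁻¹ ^ 2 - 2) * (√(n : ℝ))⁻¹ * pruneMomentNormalized n (j + 1)) +
      ∑ i ∈ range j, ((j + 1).choose i : ℝ) *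
        ((1 / 4 - 1 / 2 * (√(n : ℝ))⁻¹ ^ 2) * pruneMomentNormalized n i *
          (√(n : ℝ))⁻¹ ^ (j - i) +
        (2 * (√(n : ℝ))⁻¹ ^ 2 - 2) * pruneMomentNormalized n (i + 1) *
          (√(n : ℝ))⁻¹ ^ (j + 1 - i) +
        4 * (√(n : ℝ))⁻¹ ^ 2 * pruneMomentNormalized n (i + 2) * (√(n : ℝ))⁻¹ ^ (j - i)) := by
  have hrec := pruneMoment_recurrence hn (j + 1)
  have hn0 : (0 : ℝ) < n := by exact_mod_cast hn
  obtain ⟨x, hx⟩ : ∃ x : ℝ, x = √(n : ℝ) := ⟨_, rfl⟩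
  have hx0 : 0 < x := by rw [hx]; positivity
  have hxn : (n : ℝ) = x ^ 2 := by rw [hx, Real.sq_sqrt hn0.le]
  have hM : ∀ k, pruneMoment n k = pruneMomentNormalized n k * x ^ k := by
    intro k
    rw [pruneMomentNormalized, ← hx]
    field_simp
  simp only [hM, hxn] at hrec
  rw [← hx]
  generalize pruneMomentNormalized n = M at *
  have hsum : ∑ i ∈ range j, ((j + 1).choose i : ℝ) *
        (((x ^ 2) ^ 2 / 4 - x ^ 2 / 2) * (M i * x ^ i) +
        (2 - 2 * x ^ 2) * (M (i + 1) * x ^ (i + 1)) + 4 * (M (i + 2) * x ^ (i + 2))) =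
      x ^ (j + 4) * ∑ i ∈ range j, ((j + 1).choose i : ℝ) *
        ((1 / 4 - 1 / 2 * x⁻¹ ^ 2) * M i * x⁻¹ ^ (j - i) +
        (2 * x⁻¹ ^ 2 - 2) * M (i + 1) * x⁻¹ ^ (j + 1 - i) +
        4 * x⁻¹ ^ 2 * M (i + 2) * x⁻¹ ^ (j - i)) := by
    rw [mul_sum]
    refine sum_congr rfl fun i hi => ?_
    obtain ⟨d, rfl⟩ := Nat.exists_eq_add_of_le (mem_range.1 hi).le
    rw [show i + d - i = d by omega, show i + d + 1 - i = d + 1 by omega]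
    have hpow : x ^ (i + d + 4) * x⁻¹ ^ d = x ^ (i + 4) := by
      rw [inv_pow, show i + d + 4 = i + 4 + d by ring, pow_add, mul_assoc,
        mul_inv_cancel₀ (by positivity), mul_one]
    trans ((i + d + 1).choose i : ℝ) * ((1 / 4 - 1 / 2 * x⁻¹ ^ 2) * M i +
      (2 * x⁻¹ ^ 2 - 2) * M (i + 1) * x⁻¹ + 4 * x⁻¹ ^ 2 * M (i + 2)) * x ^ (i + 4)
    · field_simp
      ring
    · rw [← hpow]
      ring
  rw [sum_range_succ, hsum] at hrec
  have hpos : x ^ (j + 4) ≠ 0 := by positivity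
  refine mul_left_cancel₀ hpos ?_
  clear hsum
  generalize ∑ i ∈ range j, ((j + 1).choose i : ℝ) * _ = S at *
  rw [Nat.choose_succ_self_right] at hrec
  push_cast at hrec
  have hS : x ^ (j + 4) * S = (4 * x ^ 2 - 6) * (M (j + 2) * x ^ (j + 2)) -
      x ^ 2 / 2 * (M (j + 1) * x ^ (j + 1)) - (j + 1) *
      (((x ^ 2) ^ 2 / 4 - x ^ 2 / 2) * (M j * x ^ j) + (2 - 2 * x ^ 2) *
        (M (j + 1) * x ^ (j + 1)) + 4 * (M (j + 2) * x ^ (j + 2))) := by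
    linear_combination -hrec
  rw [mul_add, hS]
  field_simp
  ring

lemma tendsto_inv_sqrt : Tendsto (fun n : ℕ => (√(n : ℝ))⁻¹) atTop (𝓝 0) :=
  tendsto_inv_atTop_zero.comp (Real.tendsto_sqrt_atTop.comp tendsto_natCast_atTop_atTop)

lemma tendsto_pruneMomentNormalized (j : ℕ) :
    Tendsto (fun n => pruneMomentNormalized n j) atTop (𝓝 (gaussMoment (1 / 16) j)) := by
  have hu := tendsto_inv_sqrt
  have hpow : ∀ k, k ≠ 0 → Tendsto (fun n : ℕ => (√(n : ℝ))⁻¹ ^ k) atTop (𝓝 0) := by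
    intro k hk
    simpa [hk] using hu.pow k
  induction j using Nat.strong_induction_on with
  | _ j ih =>
    match j with
    | 0 =>
      refine tendsto_const_nhds.congr' ?_
      filter_upwards [eventually_ge_atTop 2] with n hn
      simp [pruneMomentNormalized, pruneMoment, sum_pruneLaw hn, gaussMoment]
    | 1 =>
      have hden : Tendsto (fun n : ℕ => 4 - 6 * (√(n : ℝ))⁻¹ ^ 2) atTop (𝓝 (4 - 6 * 0)) :=
        tendsto_const_nhds.sub ((hpow 2 two_ne_zero).const_mul 6)
      have hnum := ((ih 0 (by omega)).const_mul (1 / 2)).mul hu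
      have h := hnum.div hden (by norm_num)
      simp only [mul_zero, zero_div, sub_zero] at h
      rw [gaussMoment]
      refine h.congr' ?_
      filter_upwards [eventually_ge_atTop 2,
        hden.eventually_ne (show (4 - 6 * 0 : ℝ) ≠ 0 by norm_num)] with n hn hne
      have hrec := pruneMoment_recurrence (n := n) (by omega) 0
      simp only [range_zero, sum_empty, add_zero, zero_add] at hrec
      have hn0 : (0 : ℝ) < n := by exact_mod_cast (by omega : 0 < n)
      simp only [Pi.div_apply]
      rw [div_eq_iff hne]
      simp only [pruneMomentNormalized, pow_zero, div_one, pow_one]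
      obtain ⟨x, hx⟩ : ∃ x : ℝ, x = √(n : ℝ) := ⟨_, rfl⟩
      have hx0 : 0 < x := by rw [hx]; positivity
      have hxn : (n : ℝ) = x ^ 2 := by rw [hx, Real.sq_sqrt hn0.le]
      rw [hxn] at hrec
      rw [← hx]
      field_simp
      linear_combination -2 * hrec
    | j + 2 =>
      have hden : Tendsto (fun n : ℕ => 4 - (10 + 4 * (j : ℝ)) * (√(n : ℝ))⁻¹ ^ 2) atTop
          (𝓝 (4 - (10 + 4 * (j : ℝ)) * 0)) :=
        tendsto_const_nhds.sub ((hpow 2 two_ne_zero).const_mul _)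
      have hne0 : 4 - (10 + 4 * (j : ℝ)) * 0 ≠ 0 := by norm_num
      have h1 := (hu.const_mul (1 / 2)).mul (ih (j + 1) (by omega))
      have hA : Tendsto (fun n : ℕ => 1 / 4 - 1 / 2 * (√(n : ℝ))⁻¹ ^ 2) atTop
          (𝓝 (1 / 4 - 1 / 2 * 0)) :=
        tendsto_const_nhds.sub ((hpow 2 two_ne_zero).const_mul _)
      have hB : Tendsto (fun n : ℕ => 2 * (√(n : ℝ))⁻¹ ^ 2 - 2) atTop (𝓝 (2 * 0 - 2)) :=
        ((hpow 2 two_ne_zero).const_mul _).sub_const _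
      have hC := (hpow 2 two_ne_zero).const_mul 4
      have h2 := ((hA.mul (ih j (by omega))).add
        ((hB.mul hu).mul (ih (j + 1) (by omega)))).const_mul ((j : ℝ) + 1)
      have h3 : Tendsto (fun n : ℕ => ∑ i ∈ range j, ((j + 1).choose i : ℝ) *
        ((1 / 4 - 1 / 2 * (√(n : ℝ))⁻¹ ^ 2) * pruneMomentNormalized n i *
          (√(n : ℝ))⁻¹ ^ (j - i) +
        (2 * (√(n : ℝ))⁻¹ ^ 2 - 2) * pruneMomentNormalized n (i + 1) *
          (√(n : ℝ))⁻¹ ^ (j + 1 - i) +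
        4 * (√(n : ℝ))⁻¹ ^ 2 * pruneMomentNormalized n (i + 2) * (√(n : ℝ))⁻¹ ^ (j - i)))
          atTop (𝓝 (∑ i ∈ range j, 0)) := by
        refine tendsto_finsetSum _ fun i hi => ?_
        have hij := mem_range.1 hi
        have e1 := (hA.mul (ih i (by omega))).mul (hpow (j - i) (by omega))
        have e2 := (hB.mul (ih (i + 1) (by omega))).mul (hpow (j + 1 - i) (by omega))
        have e3 := (hC.mul (ih (i + 2) (by omega))).mul (hpow (j - i) (by omega))
        simpa using ((e1.add e2).add e3).const_mul ((j + 1).choose i : ℝ)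
      have h := ((h1.add h2).add h3).div hden hne0
      have hlim : (1 / 2 * 0 * gaussMoment (1 / 16) (j + 1) + ((j : ℝ) + 1) *
          ((1 / 4 - 1 / 2 * 0) * gaussMoment (1 / 16) j +
          (2 * 0 - 2) * 0 * gaussMoment (1 / 16) (j + 1)) + ∑ i ∈ range j, 0) /
          (4 - (10 + 4 * (j : ℝ)) * 0) = gaussMoment (1 / 16) (j + 2) := by
        rw [gaussMoment, sum_const_zero]
        ring
      rw [hlim] at h
      refine h.congr' ?_
      filter_upwards [eventually_ge_atTop 1, hden.eventually_ne hne0] with n hn hne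
      rw [Pi.div_apply, div_eq_iff hne, mul_comm (pruneMomentNormalized n (j + 2)),
        pruneMomentNormalized_recurrence hn j]

lemma eventually_sq_le {h : ℕ → ℝ} {j : ℕ} {L : ℝ}
    (hL : Tendsto (fun m : ℕ => h m / √(m : ℝ) ^ j) atTop (𝓝 L)) {ε : ℝ} (hε : 0 < ε) :
    ∃ K : ℝ, ∀ᶠ n : ℕ in atTop, ∀ m : ℕ, 1 ≤ m → m ≤ n →
      (h m / √(n : ℝ) ^ j - L * (1 / 2) ^ j) ^ 2 ≤ ε + K * ((m : ℝ) / n - 1 / 4) ^ 2 := by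
  obtain ⟨q, hq⟩ : ∃ q : ℕ → ℝ, q = fun m : ℕ => h m / √(m : ℝ) ^ j := ⟨_, rfl⟩
  rw [← hq] at hL
  obtain ⟨C, hC⟩ : ∃ C, ∀ m, |q m| ≤ C := by
    obtain ⟨C, hC⟩ := (Metric.isBounded_range_of_tendsto q hL).exists_norm_le
    exact ⟨C, fun m => hC _ ⟨m, rfl⟩⟩
  have hC0 : 0 ≤ C := (abs_nonneg _).trans (hC 0)
  have hsqrt : √(1 / 4 : ℝ) = 1 / 2 := by
    rw [show (1 / 4 : ℝ) = (1 / 2) ^ 2 by norm_num]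
    exact Real.sqrt_sq (by norm_num)
  have hcont : ContinuousAt (fun p : ℝ × ℝ => (p.1 * √p.2 ^ j - L * (1 / 2) ^ j) ^ 2)
      (L, 1 / 4) := by fun_prop
  have hev : ∀ᶠ p in 𝓝 (L, (1 / 4 : ℝ)), (p.1 * √p.2 ^ j - L * (1 / 2) ^ j) ^ 2 < ε := by
    refine hcont.eventually_lt continuousAt_const ?_
    simp only [hsqrt, sub_self]
    simpa using hε
  obtain ⟨δ, hδ, hball⟩ := Metric.eventually_nhds_iff.1 hev
  obtain ⟨N, hN⟩ := Metric.tendsto_atTop.1 hL δ hδ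
  obtain ⟨η, hη⟩ : ∃ η, η = min δ (1 / 8) := ⟨_, rfl⟩
  have hη0 : 0 < η := by rw [hη]; positivity
  have hηδ : η ≤ δ := hη ▸ min_le_left _ _
  have hη8 : η ≤ 1 / 8 := hη ▸ min_le_right _ _
  refine ⟨(C + |L|) ^ 2 / η ^ 2, ?_⟩
  filter_upwards [eventually_ge_atTop (8 * N), eventually_ge_atTop 1] with n hn hn1 m hm hmn
  have hn0 : (0 : ℝ) < n := by exact_mod_cast hn1
  have hm0 : (0 : ℝ) < m := by exact_mod_cast hm
  have hmn' : (m : ℝ) ≤ n := by exact_mod_cast hmn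
  have heq : h m / √(n : ℝ) ^ j = q m * √((m : ℝ) / n) ^ j := by
    have := Real.sqrt_pos.2 hm0
    rw [hq, Real.sqrt_div hm0.le, div_pow]
    field_simp
  rw [heq]
  by_cases hd : |(m : ℝ) / n - 1 / 4| < η
  · have h1 : (1 / 8 : ℝ) < (m : ℝ) / n := by
      have := (abs_lt.1 hd).1
      linarith
    rw [lt_div_iff₀ hn0] at h1
    have h2 : (8 * N : ℝ) ≤ n := by exact_mod_cast hn
    have h3 : N ≤ m := by
      have : (N : ℝ) ≤ m := by linarith
      exact_mod_cast this
    have h4 := @hball (q m, (m : ℝ) / n) (by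
      rw [Prod.dist_eq, max_lt_iff]
      exact ⟨hN m h3, by rw [Real.dist_eq]; exact hd.trans_le hηδ⟩)
    have h5 : 0 ≤ (C + |L|) ^ 2 / η ^ 2 * ((m : ℝ) / n - 1 / 4) ^ 2 := by positivity
    simp only at h4
    linarith
  · rw [not_lt] at hd
    have h1 : η ^ 2 ≤ ((m : ℝ) / n - 1 / 4) ^ 2 := by
      rw [← sq_abs ((m : ℝ) / n - 1 / 4)]
      exact pow_le_pow_left₀ hη0.le hd 2
    have h2 : (C + |L|) ^ 2 ≤ (C + |L|) ^ 2 / η ^ 2 * ((m : ℝ) / n - 1 / 4) ^ 2 := by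
      rw [div_mul_eq_mul_div, le_div_iff₀ (by positivity)]
      exact mul_le_mul_of_nonneg_left h1 (by positivity)
    have hs : √((m : ℝ) / n) ^ j ≤ 1 := by
      refine pow_le_one₀ (Real.sqrt_nonneg _) ?_
      exact Real.sqrt_le_one.2 ((div_le_one hn0).2 hmn')
    have hh : ((1 : ℝ) / 2) ^ j ≤ 1 := pow_le_one₀ (by norm_num) (by norm_num)
    have h3 : |q m * √((m : ℝ) / n) ^ j - L * (1 / 2) ^ j| ≤ C + |L| := by
      refine (abs_sub _ _).trans (add_le_add ?_ ?_)
      · rw [abs_mul, abs_of_nonneg (pow_nonneg (Real.sqrt_nonneg _) _)]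
        exact (mul_le_of_le_one_right (abs_nonneg _) hs).trans (hC m)
      · rw [abs_mul, abs_of_nonneg (by positivity : (0 : ℝ) ≤ (1 / 2) ^ j)]
        exact mul_le_of_le_one_right (abs_nonneg _) hh
    have h4 : (q m * √((m : ℝ) / n) ^ j - L * (1 / 2) ^ j) ^ 2 ≤ (C + |L|) ^ 2 := by
      rw [← sq_abs]
      exact pow_le_pow_left₀ (abs_nonneg _) h3 2
    linarith

lemma tendsto_sum_pruneLaw_sq {h : ℕ → ℝ} {j : ℕ} {L : ℝ}
    (hL : Tendsto (fun m : ℕ => h m / √(m : ℝ) ^ j) atTop (𝓝 L)) :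
    Tendsto (fun n : ℕ => ∑ m ∈ range (n + 1),
      pruneLaw n m * (h m / √(n : ℝ) ^ j - L * (1 / 2) ^ j) ^ 2) atTop (𝓝 0) := by
  rw [Metric.tendsto_atTop']
  intro ε hε
  obtain ⟨K, hK⟩ := eventually_sq_le hL (half_pos hε)
  have hvar : Tendsto (fun n : ℕ => ε / 2 + K * (pruneMomentNormalized n 2 *
      (√(n : ℝ))⁻¹ ^ 2)) atTop (𝓝 (ε / 2)) := by
    have := (((tendsto_pruneMomentNormalized 2).mul (tendsto_inv_sqrt.pow 2)).const_mul K).const_add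
      (ε / 2)
    simpa using this
  have hlt := hvar.eventually_lt_const (half_lt_self hε)
  obtain ⟨N, hN⟩ := eventually_atTop.1 (hK.and (hlt.and (eventually_ge_atTop 2)))
  refine ⟨N, fun n hn => ?_⟩
  obtain ⟨h1, h2, h3⟩ := hN n hn.le
  have hn0 : (0 : ℝ) < n := by exact_mod_cast (by omega : 0 < n)
  have hnn : 0 ≤ ∑ m ∈ range (n + 1),
      pruneLaw n m * (h m / √(n : ℝ) ^ j - L * (1 / 2) ^ j) ^ 2 :=
    sum_nonneg fun m _ => mul_nonneg (pruneLaw_nonneg n m) (sq_nonneg _)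
  rw [Real.dist_0_eq_abs, abs_of_nonneg hnn]
  refine lt_of_le_of_lt ?_ h2
  have h4 : ∑ m ∈ range (n + 1), pruneLaw n m * (ε / 2 + K * ((m : ℝ) / n - 1 / 4) ^ 2) =
      ε / 2 + K * (pruneMomentNormalized n 2 * (√(n : ℝ))⁻¹ ^ 2) := by
    have h5 : ∀ m : ℕ, pruneLaw n m * (ε / 2 + K * ((m : ℝ) / n - 1 / 4) ^ 2) =
        ε / 2 * pruneLaw n m + K / n ^ 2 * (pruneLaw n m * ((m : ℝ) - n / 4) ^ 2) := by
      intro m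
      field_simp
    simp only [h5, sum_add_distrib, ← mul_sum, sum_pruneLaw h3]
    rw [pruneMomentNormalized, ← pruneMoment, inv_pow, Real.sq_sqrt hn0.le]
    field_simp
  rw [← h4]
  refine sum_le_sum fun m hm => ?_
  rcases Nat.eq_zero_or_pos m with rfl | hm0
  · simp [pruneLaw, treesOf]
  · exact mul_le_mul_of_nonneg_left (h1 m hm0 (Nat.lt_succ_iff.1 (mem_range.1 hm)))
      (pruneLaw_nonneg n m)

lemma tendsto_sum_pruneLaw_mul {h : ℕ → ℝ} {j : ℕ} {L : ℝ}
    (hL : Tendsto (fun m : ℕ => h m / √(m : ℝ) ^ j) atTop (𝓝 L)) (i : ℕ) :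
    Tendsto (fun n : ℕ => (∑ m ∈ range (n + 1),
      pruneLaw n m * (h m * ((m : ℝ) - n / 4) ^ i)) / √(n : ℝ) ^ (j + i)) atTop
      (𝓝 (L * (1 / 2) ^ j * gaussMoment (1 / 16) i)) := by
  obtain ⟨D, hD⟩ : ∃ D : ℕ → ℝ, D = fun n : ℕ => ∑ m ∈ range (n + 1), pruneLaw n m *
      ((h m / √(n : ℝ) ^ j - L * (1 / 2) ^ j) * (((m : ℝ) - n / 4) ^ i / √(n : ℝ) ^ i)) :=
    ⟨_, rfl⟩
  have hD0 : Tendsto D atTop (𝓝 0) := by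
    have hprod := (tendsto_sum_pruneLaw_sq hL).mul (tendsto_pruneMomentNormalized (2 * i))
    rw [zero_mul] at hprod
    have hsq : Tendsto (fun n => D n ^ 2) atTop (𝓝 0) := by
      refine squeeze_zero (fun n => sq_nonneg _) (fun n => ?_) hprod
      have hb : pruneMomentNormalized n (2 * i) = ∑ m ∈ range (n + 1), pruneLaw n m *
          (((m : ℝ) - n / 4) ^ i / √(n : ℝ) ^ i) ^ 2 := by
        rw [pruneMomentNormalized, pruneMoment, sum_div]
        refine sum_congr rfl fun m _ => ?_
        rw [div_pow, ← pow_mul, ← pow_mul, mul_comm i 2, mul_div_assoc]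
      rw [hb, hD]
      refine sum_sq_le_sum_mul_sum_of_sq_le_mul _
        (fun m _ => mul_nonneg (pruneLaw_nonneg n m) (sq_nonneg _))
        (fun m _ => mul_nonneg (pruneLaw_nonneg n m) (sq_nonneg _)) fun m _ => le_of_eq ?_
      ring
    have habs := hsq.sqrt
    simp only [Real.sqrt_sq_eq_abs, Real.sqrt_zero] at habs
    exact (tendsto_zero_iff_abs_tendsto_zero _).2 habs
  have hsum := hD0.add ((tendsto_pruneMomentNormalized i).const_mul (L * (1 / 2) ^ j))
  rw [zero_add] at hsum
  refine hsum.congr fun n => ?_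
  rw [hD, pruneMomentNormalized, pruneMoment, sum_div, mul_sum, ← sum_add_distrib, sum_div]
  refine sum_congr rfl fun m _ => ?_
  rw [pow_add, ← div_div]
  ring

lemma expect_sum {ι : Type*} (t : Finset ι) (n : ℕ) (f : ι → BinTree → ℝ) :
    _root_.expect n (fun τ => ∑ i ∈ t, f i τ) = ∑ i ∈ t, _root_.expect n (f i) := by
  simp only [_root_.expect]
  rw [sum_comm, sum_div]

lemma expect_mul_const (n : ℕ) (f : BinTree → ℝ) (c : ℝ) :
    _root_.expect n (fun τ => f τ * c) = _root_.expect n f * c := by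
  simp only [_root_.expect]
  rw [← sum_mul]
  ring

/-- Convergence of all normalized central moments of the branch numbers to those of a centered
normal distribution. -/
theorem tendsto_expect_branches (r j : ℕ) :
    Tendsto (fun n : ℕ => _root_.expect n (fun τ =>
      ((branches (r + 1) τ : ℝ) - (n : ℝ) / 4 ^ r) ^ j) / √(n : ℝ) ^ j) atTop
      (𝓝 (gaussMoment ((4 ^ r - 1) / (3 * 16 ^ r)) j)) := by
  induction r generalizing j with
  | zero =>
    have hg : gaussMoment ((4 ^ 0 - 1) / (3 * 16 ^ 0)) j = 0 ^ j := by
      rw [show ((4 : ℝ) ^ 0 - 1) / (3 * 16 ^ 0) = 0 ^ 2 * 1 by norm_num, gaussMoment_scale]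
      cases j <;> simp [gaussMoment]
    rw [hg]
    refine tendsto_const_nhds.congr' ?_
    filter_upwards [eventually_ge_atTop 1] with n hn
    have : ∀ τ ∈ treesOf n, ((branches (0 + 1) τ : ℝ) - (n : ℝ) / 4 ^ 0) ^ j = 0 ^ j := by
      intro τ hτ
      rw [zero_add, branches_one, (mem_treesOf _ _).1 hτ]
      simp
    rw [expect_congr this, expect_const hn]
    cases j <;> simp
  | succ r ih =>
    have hlim : Tendsto (fun n : ℕ => ∑ i ∈ range (j + 1), (j.choose i : ℝ) * (1 / 4 ^ r) ^ (j - i) *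
        ((∑ m ∈ range (n + 1), pruneLaw n m * (_root_.expect m (fun τ =>
          ((branches (r + 1) τ : ℝ) - (m : ℝ) / 4 ^ r) ^ i) * ((m : ℝ) - n / 4) ^ (j - i))) /
          √(n : ℝ) ^ (i + (j - i)))) atTop
        (𝓝 (∑ i ∈ range (j + 1), (j.choose i : ℝ) * (1 / 4 ^ r) ^ (j - i) *
          (gaussMoment ((4 ^ r - 1) / (3 * 16 ^ r)) i * (1 / 2) ^ i *
            gaussMoment (1 / 16) (j - i)))) :=
      tendsto_finsetSum _ fun i _ => (tendsto_sum_pruneLaw_mul (ih i) (j - i)).const_mul _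
    have hg : ∑ i ∈ range (j + 1), (j.choose i : ℝ) * (1 / 4 ^ r) ^ (j - i) *
          (gaussMoment ((4 ^ r - 1) / (3 * 16 ^ r)) i * (1 / 2) ^ i *
            gaussMoment (1 / 16) (j - i)) =
        gaussMoment ((4 ^ (r + 1) - 1) / (3 * 16 ^ (r + 1))) j := by
      have hv : ((4 : ℝ) ^ (r + 1) - 1) / (3 * 16 ^ (r + 1)) =
          (1 / 2) ^ 2 * ((4 ^ r - 1) / (3 * 16 ^ r)) + (1 / 4 ^ r) ^ 2 * (1 / 16) := by
        rw [show (16 : ℝ) = 4 ^ 2 by norm_num, ← pow_mul, ← pow_mul]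
        field_simp
        ring
      rw [hv, ← sum_choose_gaussMoment]
      refine sum_congr rfl fun i _ => ?_
      rw [gaussMoment_scale, gaussMoment_scale]
      ring
    rw [hg] at hlim
    refine hlim.congr' ?_
    filter_upwards [eventually_ge_atTop 2] with n hn
    have hexp := expect_branches_add_two r hn fun b => ((b : ℝ) - (n : ℝ) / 4 ^ (r + 1)) ^ j
    rw [show r + 1 + 1 = r + 2 by ring, hexp]
    have hm : ∀ m : ℕ, _root_.expect m (fun σ =>
        ((branches (r + 1) σ : ℝ) - (n : ℝ) / 4 ^ (r + 1)) ^ j) =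
        ∑ i ∈ range (j + 1), _root_.expect m (fun τ =>
          ((branches (r + 1) τ : ℝ) - (m : ℝ) / 4 ^ r) ^ i) *
            (((m : ℝ) - n / 4) ^ (j - i) * ((j.choose i : ℝ) * (1 / 4 ^ r) ^ (j - i))) := by
      intro m
      simp only [← expect_mul_const]
      rw [← expect_sum]
      refine expect_congr fun τ _ => ?_
      have hsplit : (branches (r + 1) τ : ℝ) - (n : ℝ) / 4 ^ (r + 1) =
          ((branches (r + 1) τ : ℝ) - (m : ℝ) / 4 ^ r) + ((m : ℝ) - n / 4) * (1 / 4 ^ r) := by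
        rw [pow_succ]
        field_simp
        ring
      rw [hsplit, add_pow]
      refine sum_congr rfl fun i _ => ?_
      rw [mul_pow]
      ring
    simp only [hm, mul_sum]
    rw [sum_comm, sum_div]
    refine sum_congr rfl fun i hi => ?_
    rw [show i + (j - i) = j by have := mem_range.1 hi; omega, ← mul_div_assoc, mul_sum]
    congr 1
    refine sum_congr rfl fun m _ => ?_
    ring

end BinTree

/-- Even central moments of branch numbers (Lemma 2, even case): for `r ≥ 1`, `s ≥ 0`,
`⟨(S_{r+1,n} − n/4^r)^{2s}⟩ ∼ ((2s−1)!!/4^{2sr}) ((4^r − 1)/3)^s n^s`. -/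
theorem even_central_moments_branches (r s : ℕ) (hr : 1 ≤ r) :
    Tendsto (fun n : ℕ =>
        expect n (fun τ =>
            ((BinTree.branches (r+1) τ : ℝ) - (n : ℝ) / 4 ^ r) ^ (2*s))
          / ((Nat.doubleFactorial (2*s - 1) : ℝ) / 4 ^ (2*s*r)
              * (((4 : ℝ) ^ r - 1) / 3) ^ s * (n : ℝ) ^ s))
      atTop (𝓝 1) := by
  have h4 : (1 : ℝ) < 4 ^ r := one_lt_pow₀ (by norm_num) (by omega)
  obtain ⟨c, hc⟩ : ∃ c : ℝ, c = (Nat.doubleFactorial (2 * s - 1) : ℝ) / 4 ^ (2 * s * r)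
      * (((4 : ℝ) ^ r - 1) / 3) ^ s := ⟨_, rfl⟩
  have hc0 : c ≠ 0 := by
    have h1 : (0 : ℝ) < (Nat.doubleFactorial (2 * s - 1) : ℝ) := by
      exact_mod_cast Nat.doubleFactorial_pos _
    have h2 : (0 : ℝ) < 4 ^ r - 1 := by linarith
    rw [hc]
    positivity
  have hlim := (BinTree.tendsto_expect_branches r (2 * s)).div_const c
  have hg : BinTree.gaussMoment ((4 ^ r - 1) / (3 * 16 ^ r)) (2 * s) = c := by
    rw [BinTree.gaussMoment_two_mul, hc, show (16 : ℝ) = 4 ^ 2 by norm_num, ← div_div, div_pow _ _ s,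
      ← pow_mul, ← pow_mul, show 2 * (r * s) = 2 * s * r by ring]
    ring
  rw [hg, div_self hc0] at hlim
  refine hlim.congr fun n => ?_
  rw [← hc, pow_mul √(n : ℝ), Real.sq_sqrt (Nat.cast_nonneg n), div_div, mul_comm c]
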